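/- For all 1 ≤ l < n ≤ L−1, the following identity of rational functions holds: Sym[C(n) · (t_{L−1}^{(1)})^{−1} f_n^{x}(t^{(1)}) · (t_{L−1}^{(2)})^{−1} f_l^{y}(t^{(2)})] = Sym[(t_{L−1}^{(1)})^{−1} f_n^{x}(t^{(1)}) · (t_{L−1}^{(2)})^{−1} f_l^{x}(t^{(2)})] + (y/(x−y)) · Sym[(t_{L−1}^{(1)} t_{L−1}^{(2)})^{−1} (f_n^{x}(t^{(1)}) − f_n^{y}(t^{(1)}))(f_l^{x}(t^{(2)}) − f_l^{y}(t^{(2)}))]. Moreover, in the degenerate case where both copies carry the same parameter x, one has Sym[C(n) · (t_{L−1}^{(1)})^{−1} f_n^{x}(t^{(1)}) · (t_{L−1}^{(2)})^{−1} f_l^{x}(t^{(2)})] = Sym[(t_{L−1}^{(1)})^{−1} f_n^{x}(t^{(1)}) · (t_{L−1}^{(2)})^{−1} f_l^{x}(t^{(2)})]. -/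

import Mathlib

noncomputable section

open Finset

/-- `f₀(t^{(a)})`, with the convention `t₀^{(a)} = u 0 a` (hypothesised to be `1`). -/
def f0 (L : ℕ) (u : ℕ → ℕ → ℂ) (a : ℕ) : ℂ :=
  ∏ m ∈ Finset.Icc 1 (L - 1), (u (m - 1) a - u m a)⁻¹

/-- `f_n^v(t^{(a)})` for a parameter `v ∈ {x, y}`. -/
def fP (L : ℕ) (v : ℂ) (n : ℕ) (u : ℕ → ℕ → ℂ) (a : ℕ) : ℂ :=
  (1 - v * u (L - 1) a)⁻¹ *
    ∏ m ∈ (Finset.Icc 1 (L - 1)).erase n, (u (m - 1) a - u m a)⁻¹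

/-- `f_{l,k}^v(t^{(a)})`. -/
def fP2 (L : ℕ) (v : ℂ) (l k : ℕ) (u : ℕ → ℕ → ℂ) (a : ℕ) : ℂ :=
  (1 - v * u (L - 1) a)⁻¹ *
    ∏ m ∈ ((Finset.Icc 1 (L - 1)).erase l).erase k, (u (m - 1) a - u m a)⁻¹

/-- The family `t` with the variables `t m 1 ↔ t m 2` swapped for `m ∈ S`. -/
def swapOn (S : Finset ℕ) (t : ℕ → ℕ → ℂ) : ℕ → ℕ → ℂ :=
  fun m a => if m ∈ S then t m (3 - a) else t m a

/-- The symmetrisation over the group `(S₂)^{L-1}`: the sum of the values of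
`g` on all families obtained from `t` by swapping `t m 1 ↔ t m 2` for `m` in a
subset of `{1, …, L-1}`. -/
def symSum (L : ℕ) (t : ℕ → ℕ → ℂ) (g : (ℕ → ℕ → ℂ) → ℂ) : ℂ :=
  ∑ S ∈ (Finset.Icc 1 (L - 1)).powerset, g (swapOn S t)

/-- The factor `C(n)`. -/
def Cf (L n : ℕ) (u : ℕ → ℕ → ℂ) : ℂ :=
  (∑ m ∈ Finset.Icc n (L - 1),
      u m 1 * (-(u m 1 - u (m - 1) 2)⁻¹ + 2 * (u m 1 - u m 2)⁻¹))
  - (∑ m ∈ Finset.Icc n (L - 2), u m 1 * (u m 1 - u (m + 1) 2)⁻¹)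
  + (if n = 1 then u 1 1 * (u 1 1 - 1)⁻¹ else 0)

/-- The partial symmetrisation over levels `1..M`. -/
def TS (M : ℕ) (t : ℕ → ℕ → ℂ) (g : (ℕ → ℕ → ℂ) → ℂ) : ℂ :=
  ∑ S ∈ (Finset.Icc 1 M).powerset, g (swapOn S t)

/-- The chain weight up to level `M`. -/
def Wt (n l M : ℕ) (u : ℕ → ℕ → ℂ) : ℂ :=
  (∏ m ∈ (Finset.Icc 1 M).erase n, (u (m - 1) 1 - u m 1)⁻¹) *
    ∏ m ∈ (Finset.Icc 1 M).erase l, (u (m - 1) 2 - u m 2)⁻¹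

/-- `C(n)` with top level `M + 1`, for `n ≠ 1`. -/
def Cc (n M : ℕ) (u : ℕ → ℕ → ℂ) : ℂ :=
  (∑ m ∈ Finset.Icc n (M + 1),
      u m 1 * (-(u m 1 - u (m - 1) 2)⁻¹ + 2 * (u m 1 - u m 2)⁻¹))
  - (∑ m ∈ Finset.Icc n M, u m 1 * (u m 1 - u (m + 1) 2)⁻¹)

/-- Genericity up to level `M`. -/
def Good (M : ℕ) (t : ℕ → ℕ → ℂ) : Prop :=
  (∀ m, 1 ≤ m → m ≤ M → t (m - 1) 1 ≠ t m 1 ∧ t (m - 1) 1 ≠ t m 2 ∧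
    t (m - 1) 2 ≠ t m 1 ∧ t (m - 1) 2 ≠ t m 2) ∧
  ∀ m, 1 ≤ m → m ≤ M → t m 1 ≠ t m 2

lemma Good.mono {M N : ℕ} {t : ℕ → ℕ → ℂ} (h : Good N t) (hMN : M ≤ N) : Good M t :=
  ⟨fun m h1 h2 => h.1 m h1 (h2.trans hMN), fun m h1 h2 => h.2 m h1 (h2.trans hMN)⟩

lemma Good.swap {M : ℕ} {t : ℕ → ℕ → ℂ} (h : Good M t) (S : Finset ℕ) :
    Good M (swapOn S t) := by
  refine ⟨fun m h1 h2 => ?_, fun m h1 h2 => ?_⟩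
  · obtain ⟨p, q, r, s⟩ := h.1 m h1 h2
    unfold swapOn
    split_ifs <;> simp_all
  · have := h.2 m h1 h2
    unfold swapOn
    split_ifs
    · simpa using this.symm
    · exact this

lemma Wt_congr (n l M : ℕ) (u v : ℕ → ℕ → ℂ)
    (h : ∀ m, m ≤ M → u m 1 = v m 1 ∧ u m 2 = v m 2) : Wt n l M u = Wt n l M v := by
  unfold Wt
  congr 1
  all_goals
    refine Finset.prod_congr rfl fun m hm => ?_
    have hm' := (Finset.mem_Icc.1 (Finset.mem_of_mem_erase hm)).2
    have h1 := h m hm'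
    have h2 := h (m - 1) (by omega)
    simp only [h1.1, h1.2, h2.1, h2.2]

lemma Wt_succ (n l M : ℕ) (u : ℕ → ℕ → ℂ) (hn : n ≤ M) (hl : l ≤ M) :
    Wt n l (M + 1) u =
      (u M 1 - u (M + 1) 1)⁻¹ * (u M 2 - u (M + 1) 2)⁻¹ * Wt n l M u := by
  unfold Wt
  have e : Finset.Icc 1 (M + 1) = insert (M + 1) (Finset.Icc 1 M) := by
    ext k; simp only [Finset.mem_Icc, Finset.mem_insert]; omega
  rw [e, Finset.erase_insert_of_ne (by omega), Finset.erase_insert_of_ne (by omega),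
    Finset.prod_insert (by simp), Finset.prod_insert (by simp)]
  simp only [Nat.add_sub_cancel]
  ring

lemma Cc_succ (n M : ℕ) (u : ℕ → ℕ → ℂ) (hn : n ≤ M + 1) :
    Cc n (M + 1) u = Cc n M u +
      (u (M + 2) 1 * (-(u (M + 2) 1 - u (M + 1) 2)⁻¹ + 2 * (u (M + 2) 1 - u (M + 2) 2)⁻¹)
        - u (M + 1) 1 * (u (M + 1) 1 - u (M + 2) 2)⁻¹) := by
  unfold Cc
  rw [Finset.sum_Icc_succ_top (by omega : n ≤ M + 1 + 1), Finset.sum_Icc_succ_top hn (fun m => u m 1 * (u m 1 - u (m + 1) 2)⁻¹)]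
  simp only [Nat.add_sub_cancel]
  ring

lemma swapOn_of_notMem {S : Finset ℕ} {m : ℕ} (h : m ∉ S) (t : ℕ → ℕ → ℂ) (a : ℕ) :
    swapOn S t m a = t m a := by simp [swapOn, h]

lemma TS_succ (M : ℕ) (t : ℕ → ℕ → ℂ) (g : (ℕ → ℕ → ℂ) → ℂ) :
    TS (M + 1) t g = TS M t g + TS M (swapOn {M + 1} t) g := by
  unfold TS
  have e : Finset.Icc 1 (M + 1) = insert (M + 1) (Finset.Icc 1 M) := by
    ext k; simp only [Finset.mem_Icc, Finset.mem_insert]; omega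
  rw [e, Finset.sum_powerset_insert (by simp)]
  congr 1
  refine Finset.sum_congr rfl fun S hS => ?_
  have hM : M + 1 ∉ S := fun h => by
    have := Finset.mem_Icc.1 (Finset.mem_powerset.1 hS h); omega
  congr 1
  funext m a
  by_cases h : m = M + 1
  · subst h; simp [swapOn, hM]
  · simp [swapOn, h]

lemma notMem_of {M m : ℕ} {S : Finset ℕ} (hS : S ∈ (Finset.Icc 1 M).powerset) (h : M < m) :
    m ∉ S := fun h' => by
  have := Finset.mem_Icc.1 (Finset.mem_powerset.1 hS h'); omega

lemma TS_Wt_congr (n l N M : ℕ) (t t' : ℕ → ℕ → ℂ)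
    (h : ∀ m, m ≤ M → t m 1 = t' m 1 ∧ t m 2 = t' m 2) :
    TS N t (Wt n l M) = TS N t' (Wt n l M) := by
  unfold TS
  refine Finset.sum_congr rfl fun S _ => Wt_congr _ _ _ _ _ fun m hm => ?_
  have := h m hm
  unfold swapOn
  split_ifs
  · exact ⟨this.2, this.1⟩
  · exact this

lemma TS_swap_swap (n l N M K : ℕ) (t : ℕ → ℕ → ℂ) :
    TS N (swapOn {K} (swapOn {K} t)) (Wt n l M) = TS N t (Wt n l M) := by
  refine TS_Wt_congr _ _ _ _ _ _ fun m _ => ?_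
  by_cases h : m = K <;> simp [swapOn, h]

lemma TS_Wt_succ (n l M : ℕ) (t : ℕ → ℕ → ℂ) (hn : n ≤ M + 1) (hl : l ≤ M + 1) :
    TS M t (Wt n l (M + 2)) =
      (t (M + 1) 1 - t (M + 2) 1)⁻¹ * (t (M + 1) 2 - t (M + 2) 2)⁻¹ *
        TS M t (Wt n l (M + 1)) := by
  unfold TS
  rw [Finset.mul_sum]
  refine Finset.sum_congr rfl fun S hS => ?_
  rw [Wt_succ n l (M + 1) _ hn hl]
  simp only [swapOn_of_notMem (notMem_of hS (by omega : M < M + 1)),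
    swapOn_of_notMem (notMem_of hS (by omega : M < M + 1 + 1))]

lemma TS_CW_succ (n l M : ℕ) (t : ℕ → ℕ → ℂ) (hn : n ≤ M + 1) (hl : l ≤ M + 1) :
    TS M t (fun u => Cc n (M + 1) u * Wt n l (M + 2) u) =
      (t (M + 1) 1 - t (M + 2) 1)⁻¹ * (t (M + 1) 2 - t (M + 2) 2)⁻¹ *
        (TS M t (fun u => Cc n M u * Wt n l (M + 1) u) +
        (t (M + 2) 1 * (-(t (M + 2) 1 - t (M + 1) 2)⁻¹ + 2 * (t (M + 2) 1 - t (M + 2) 2)⁻¹)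
        - t (M + 1) 1 * (t (M + 1) 1 - t (M + 2) 2)⁻¹) * TS M t (Wt n l (M + 1))) := by
  unfold TS
  rw [Finset.mul_sum, ← Finset.sum_add_distrib, Finset.mul_sum]
  refine Finset.sum_congr rfl fun S hS => ?_
  beta_reduce
  rw [Wt_succ n l (M + 1) _ hn hl, Cc_succ n M _ hn]
  simp only [swapOn_of_notMem (notMem_of hS (by omega : M < M + 1)),
    swapOn_of_notMem (notMem_of hS (by omega : M < M + 1 + 1)),
    swapOn_of_notMem (notMem_of hS (by omega : M < M + 2))]
  ring

lemma coef_id (a b c d : ℂ) (hab : a - b ≠ 0) (hcd : c - d ≠ 0) (hac : a - c ≠ 0)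
    (had : a - d ≠ 0) (hbc : b - c ≠ 0) (hbd : b - d ≠ 0) :
    (a - c)⁻¹ * (b - d)⁻¹ * (a / (a - b) + (c * (-(c - b)⁻¹ + 2 * (c - d)⁻¹) - a * (a - d)⁻¹))
      + (b - c)⁻¹ * (a - d)⁻¹ * (b / (b - a)) =
    c / (c - d) * ((a - c)⁻¹ * (b - d)⁻¹ + (b - c)⁻¹ * (a - d)⁻¹) := by
  have h1 : (c - b)⁻¹ = -(b - c)⁻¹ := by rw [← inv_neg, neg_sub]
  have h2 : b / (b - a) = -(b / (a - b)) := by rw [← div_neg, neg_sub]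
  rw [h1, h2]
  field_simp
  ring

lemma step_id (a b c d e e' : ℂ) (hab : a - b ≠ 0) (hcd : c - d ≠ 0) (hac : a - c ≠ 0)
    (had : a - d ≠ 0) (hbc : b - c ≠ 0) (hbd : b - d ≠ 0) :
    (a - c)⁻¹ * (b - d)⁻¹ * (a / (a - b) * (e + e') +
        (c * (-(c - b)⁻¹ + 2 * (c - d)⁻¹) - a * (a - d)⁻¹) * e)
      + (b - c)⁻¹ * (a - d)⁻¹ * (b / (b - a) * (e' + e) +
        (c * (-(c - a)⁻¹ + 2 * (c - d)⁻¹) - b * (b - d)⁻¹) * e') =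
    c / (c - d) * (((a - c)⁻¹ * (b - d)⁻¹ * e + (b - c)⁻¹ * (a - d)⁻¹ * e') +
      ((a - d)⁻¹ * (b - c)⁻¹ * e + (b - d)⁻¹ * (a - c)⁻¹ * e')) := by
  have h1 := coef_id a b c d hab hcd hac had hbc hbd
  have h2 := coef_id b a c d (by rw [← neg_sub]; exact neg_ne_zero.2 hab) hcd hbc hbd hac had
  linear_combination e * h1 + e' * h2

lemma base_id (a b c : ℂ) (hab : a - b ≠ 0) (hca : c - a ≠ 0) (hcb : c - b ≠ 0) :
    a * (-(a - c)⁻¹ + 2 * (a - b)⁻¹) * (c - b)⁻¹ =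
      a / (a - b) * ((c - b)⁻¹ + (c - a)⁻¹) := by
  have h1 : (a - c)⁻¹ = -(c - a)⁻¹ := by rw [← inv_neg, neg_sub]
  rw [h1]
  field_simp
  ring

lemma Wt_base (l M : ℕ) (hl : l ≤ M) (u : ℕ → ℕ → ℂ) :
    Wt (M + 1) l (M + 1) u = Wt (M + 1) l M u * (u M 2 - u (M + 1) 2)⁻¹ := by
  unfold Wt
  have e : Finset.Icc 1 (M + 1) = insert (M + 1) (Finset.Icc 1 M) := by
    ext k; simp only [Finset.mem_Icc, Finset.mem_insert]; omega
  rw [e, Finset.erase_insert_of_ne (a := M + 1) (b := l) (by omega),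
    Finset.prod_insert (by simp), Finset.erase_insert (by simp),
    Finset.erase_eq_of_notMem (s := Finset.Icc 1 M) (a := M + 1) (by simp)]
  simp only [Nat.add_sub_cancel]
  ring

lemma key_base (l M : ℕ) (hl : l ≤ M) (t : ℕ → ℕ → ℂ) (ht : Good (M + 1) t) :
    TS M t (fun u => Cc (M + 1) M u * Wt (M + 1) l (M + 1) u) =
      t (M + 1) 1 / (t (M + 1) 1 - t (M + 1) 2) *
        (TS M t (Wt (M + 1) l (M + 1)) + TS M (swapOn {M + 1} t) (Wt (M + 1) l (M + 1))) := by
  unfold TS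
  rw [← Finset.sum_add_distrib, Finset.mul_sum]
  refine Finset.sum_congr rfl fun S hS => ?_
  have hM := notMem_of hS (by omega : M < M + 1)
  have g := ht.swap S
  have e1 : Wt (M + 1) l M (swapOn S (swapOn {M + 1} t)) = Wt (M + 1) l M (swapOn S t) := by
    refine Wt_congr _ _ _ _ _ fun m hm => ?_
    have : m ≠ M + 1 := by omega
    simp [swapOn, this]
  have e2 : swapOn S (swapOn {M + 1} t) M 2 = swapOn S t M 2 := by
    simp [swapOn]
  have e3 : swapOn S (swapOn {M + 1} t) (M + 1) 2 = t (M + 1) 1 := by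
    rw [swapOn_of_notMem hM]; simp [swapOn]
  have e4 : Cc (M + 1) M (swapOn S t) = t (M + 1) 1 *
      (-(t (M + 1) 1 - swapOn S t M 2)⁻¹ + 2 * (t (M + 1) 1 - t (M + 1) 2)⁻¹) := by
    unfold Cc
    simp [swapOn_of_notMem hM]
  obtain ⟨-, -, p, q⟩ := g.1 (M + 1) (by omega) le_rfl
  have r := ht.2 (M + 1) (by omega) le_rfl
  simp only [Nat.add_sub_cancel, swapOn_of_notMem hM] at p q
  beta_reduce
  rw [Wt_base l M hl, Wt_base l M hl, e1, e2, e3, e4, swapOn_of_notMem hM]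
  have := base_id _ _ _ (sub_ne_zero.2 r) (sub_ne_zero.2 p) (sub_ne_zero.2 q)
  linear_combination Wt (M + 1) l M (swapOn S t) * this

lemma key (l k : ℕ) (hl : l ≤ k) (M : ℕ) (hM : k ≤ M) :
    ∀ t : ℕ → ℕ → ℂ, Good (M + 1) t →
    TS M t (fun u => Cc (k + 1) M u * Wt (k + 1) l (M + 1) u) =
      t (M + 1) 1 / (t (M + 1) 1 - t (M + 1) 2) *
        (TS M t (Wt (k + 1) l (M + 1)) + TS M (swapOn {M + 1} t) (Wt (k + 1) l (M + 1))) := by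
  induction M, hM using Nat.le_induction with
  | base => exact key_base l k hl
  | succ M hM ih =>
    intro t ht
    have ht1 : Good (M + 1) t := ht.mono (by omega)
    have i1 := ih t ht1
    have i2 := ih _ (ht1.swap {M + 1})
    rw [TS_swap_swap] at i2
    obtain ⟨p, q, r, s⟩ := ht.1 (M + 2) (by omega) le_rfl
    have v1 := ht.2 (M + 1) (by omega) (by omega)
    have v2 := ht.2 (M + 2) (by omega) le_rfl
    have c1 : TS M (swapOn {M + 2} t) (Wt (k + 1) l (M + 1)) = TS M t (Wt (k + 1) l (M + 1)) := by
      refine TS_Wt_congr _ _ _ _ _ _ fun m hm => ?_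
      have : m ≠ M + 2 := by omega
      simp [swapOn, this]
    have c2 : TS M (swapOn {M + 1} (swapOn {M + 2} t)) (Wt (k + 1) l (M + 1)) =
        TS M (swapOn {M + 1} t) (Wt (k + 1) l (M + 1)) := by
      refine TS_Wt_congr _ _ _ _ _ _ fun m hm => ?_
      have : m ≠ M + 2 := by omega
      simp [swapOn, this]
    rw [TS_succ, TS_succ, TS_succ]
    simp only [show M + 1 + 1 = M + 2 from rfl]
    rw [TS_CW_succ _ _ _ _ (by omega) (by omega), TS_CW_succ _ _ _ _ (by omega) (by omega),
      TS_Wt_succ _ _ _ _ (by omega) (by omega), TS_Wt_succ _ _ _ _ (by omega) (by omega),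
      TS_Wt_succ _ _ _ _ (by omega) (by omega), TS_Wt_succ _ _ _ _ (by omega) (by omega),
      c1, c2, i1, i2]
    have s1 : ∀ u : ℕ → ℕ → ℂ, swapOn {M + 1} u (M + 1) 1 = u (M + 1) 2 := by
      intro u; simp [swapOn]
    have s2 : ∀ u : ℕ → ℕ → ℂ, swapOn {M + 1} u (M + 1) 2 = u (M + 1) 1 := by
      intro u; simp [swapOn]
    have s3 : ∀ u : ℕ → ℕ → ℂ, swapOn {M + 2} u (M + 2) 1 = u (M + 2) 2 := by
      intro u; simp [swapOn]
    have s4 : ∀ u : ℕ → ℕ → ℂ, swapOn {M + 2} u (M + 2) 2 = u (M + 2) 1 := by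
      intro u; simp [swapOn]
    have s5 : ∀ (u : ℕ → ℕ → ℂ) a, swapOn {M + 1} u (M + 2) a = u (M + 2) a := by
      intro u a; simp [swapOn]
    have s6 : ∀ (u : ℕ → ℕ → ℂ) a, swapOn {M + 2} u (M + 1) a = u (M + 1) a := by
      intro u a; simp [swapOn]
    simp only [s1, s2, s3, s4, s5, s6]
    exact step_id _ _ _ _ _ _ (sub_ne_zero.2 v1) (sub_ne_zero.2 v2) (sub_ne_zero.2 p)
      (sub_ne_zero.2 q) (sub_ne_zero.2 r) (sub_ne_zero.2 s)

lemma TS_smul (M : ℕ) (t : ℕ → ℕ → ℂ) (K : ℂ → ℂ → ℂ) (g : (ℕ → ℕ → ℂ) → ℂ) :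
    TS M t (fun u => K (u (M + 1) 1) (u (M + 1) 2) * g u) =
      K (t (M + 1) 1) (t (M + 1) 2) * TS M t g := by
  unfold TS
  rw [Finset.mul_sum]
  refine Finset.sum_congr rfl fun S hS => ?_
  simp only [swapOn_of_notMem (notMem_of hS (by omega : M < M + 1))]

/-- The abstract identity. -/
lemma main_abs (l k M : ℕ) (hl : l ≤ k) (hM : k ≤ M) (t : ℕ → ℕ → ℂ) (ht : Good (M + 1) t)
    (K H : ℂ → ℂ → ℂ)
    (hH : t (M + 1) 1 * K (t (M + 1) 1) (t (M + 1) 2) -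
        t (M + 1) 2 * K (t (M + 1) 2) (t (M + 1) 1) =
      (t (M + 1) 1 - t (M + 1) 2) * H (t (M + 1) 1) (t (M + 1) 2))
    (hs : H (t (M + 1) 2) (t (M + 1) 1) = H (t (M + 1) 1) (t (M + 1) 2)) :
    TS (M + 1) t (fun u => K (u (M + 1) 1) (u (M + 1) 2) *
        (Cc (k + 1) M u * Wt (k + 1) l (M + 1) u)) =
      TS (M + 1) t (fun u => H (u (M + 1) 1) (u (M + 1) 2) * Wt (k + 1) l (M + 1) u) := by
  have s1 : swapOn {M + 1} t (M + 1) 1 = t (M + 1) 2 := by simp [swapOn]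
  have s2 : swapOn {M + 1} t (M + 1) 2 = t (M + 1) 1 := by simp [swapOn]
  have v := sub_ne_zero.2 (ht.2 (M + 1) (by omega) le_rfl)
  have hn : t (M + 1) 2 / (t (M + 1) 2 - t (M + 1) 1) =
    -(t (M + 1) 2 / (t (M + 1) 1 - t (M + 1) 2)) := by rw [← div_neg, neg_sub]
  rw [TS_succ, TS_succ, TS_smul, TS_smul, TS_smul M t H, TS_smul M _ H, key l k hl M hM t ht,
    key l k hl M hM _ (ht.swap _), TS_swap_swap, s1, s2, hs, hn]
  have hH' : H (t (M + 1) 1) (t (M + 1) 2) = (t (M + 1) 1 * K (t (M + 1) 1) (t (M + 1) 2) -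
        t (M + 1) 2 * K (t (M + 1) 2) (t (M + 1) 1)) / (t (M + 1) 1 - t (M + 1) 2) := by
    rw [hH]; field_simp
  rw [hH']
  ring

/-- The left-hand kernel. -/
def Kf (x y a b : ℂ) : ℂ := a⁻¹ * (1 - x * a)⁻¹ * (b⁻¹ * (1 - y * b)⁻¹)

/-- The right-hand kernel. -/
def Hf (x y a b : ℂ) : ℂ := a⁻¹ * (1 - x * a)⁻¹ * (b⁻¹ * (1 - x * b)⁻¹) +
  y / (x - y) * ((a * b)⁻¹ * (((1 - x * a)⁻¹ - (1 - y * a)⁻¹) * ((1 - x * b)⁻¹ - (1 - y * b)⁻¹)))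

lemma KH (x y a b : ℂ) (ha : a ≠ 0) (hb : b ≠ 0) (h1 : 1 - x * a ≠ 0) (h2 : 1 - x * b ≠ 0)
    (h3 : 1 - y * a ≠ 0) (h4 : 1 - y * b ≠ 0) (hxy : x ≠ y) :
    a * Kf x y a b - b * Kf x y b a = (a - b) * Hf x y a b := by
  have h := sub_ne_zero.2 hxy
  have h1' : 1 - a * x ≠ 0 := by rwa [mul_comm]
  have h2' : 1 - b * x ≠ 0 := by rwa [mul_comm]
  have h3' : 1 - a * y ≠ 0 := by rwa [mul_comm]
  have h4' : 1 - b * y ≠ 0 := by rwa [mul_comm]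
  unfold Kf Hf
  have e1 : (1 - x * a)⁻¹ - (1 - y * a)⁻¹ = (x - y) * a * ((1 - x * a)⁻¹ * (1 - y * a)⁻¹) := by
    field_simp; ring
  have e2 : (1 - x * b)⁻¹ - (1 - y * b)⁻¹ = (x - y) * b * ((1 - x * b)⁻¹ * (1 - y * b)⁻¹) := by
    field_simp; ring
  rw [e1, e2]
  field_simp
  ring

lemma KH' (x a b : ℂ) :
    a * Kf x x a b - b * Kf x x b a = (a - b) * Kf x x a b := by
  unfold Kf
  ring

theorem stmt9 (L : ℕ) (hL : 2 ≤ L) (t : ℕ → ℕ → ℂ) (x y : ℂ)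
    (ht01 : t 0 1 = 1) (ht02 : t 0 2 = 1)
    (hadj : ∀ m, 1 ≤ m → m ≤ L - 1 → ∀ a b, (a = 1 ∨ a = 2) → (b = 1 ∨ b = 2) →
      t (m - 1) a ≠ t m b)
    (hver : ∀ m, 1 ≤ m → m ≤ L - 1 → t m 1 ≠ t m 2)
    (hxt : ∀ a, (a = 1 ∨ a = 2) → 1 - x * t (L - 1) a ≠ 0)
    (hyt : ∀ a, (a = 1 ∨ a = 2) → 1 - y * t (L - 1) a ≠ 0)
    (htL1 : t (L - 1) 1 ≠ 0) (htL2 : t (L - 1) 2 ≠ 0)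
    (hxy : x ≠ y) (hx1 : x ≠ 1) :
    -- Statement 9 (Lemma `l < n`): both the generic (`x ≠ y`) identity and the
    -- degenerate identity where both copies carry the parameter `x`.
    ∀ l n, 1 ≤ l → l < n → n ≤ L - 1 →
      (symSum L t (fun u => Cf L n u * ((u (L - 1) 1)⁻¹ * fP L x n u 1) *
          ((u (L - 1) 2)⁻¹ * fP L y l u 2))
        = symSum L t (fun u => ((u (L - 1) 1)⁻¹ * fP L x n u 1) *
            ((u (L - 1) 2)⁻¹ * fP L x l u 2))
          + y / (x - y) *
            symSum L t (fun u => (u (L - 1) 1 * u (L - 1) 2)⁻¹ *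
              ((fP L x n u 1 - fP L y n u 1) * (fP L x l u 2 - fP L y l u 2))))
      ∧
      (symSum L t (fun u => Cf L n u * ((u (L - 1) 1)⁻¹ * fP L x n u 1) *
          ((u (L - 1) 2)⁻¹ * fP L x l u 2))
        = symSum L t (fun u => ((u (L - 1) 1)⁻¹ * fP L x n u 1) *
            ((u (L - 1) 2)⁻¹ * fP L x l u 2))) := by
  intro l n hl hln hn
  obtain ⟨M, rfl⟩ : ∃ M, L = M + 2 := ⟨L - 2, by omega⟩
  obtain ⟨k, rfl⟩ : ∃ k, n = k + 1 := ⟨n - 1, by omega⟩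
  have e : M + 2 - 1 = M + 1 := rfl
  simp only [e] at hadj hver hxt hyt htL1 htL2 hn ⊢
  have ht : Good (M + 1) t := by
    refine ⟨fun m h1 h2 => ?_, hver⟩
    have h := hadj m h1 h2
    exact ⟨h 1 1 (.inl rfl) (.inl rfl), h 1 2 (.inl rfl) (.inr rfl),
      h 2 1 (.inr rfl) (.inl rfl), h 2 2 (.inr rfl) (.inr rfl)⟩
  have hC : ∀ u, Cf (M + 2) (k + 1) u = Cc (k + 1) M u := by
    intro u
    have : k + 1 ≠ 1 := by omega
    unfold Cf Cc
    rw [if_neg this, add_zero]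
    rfl
  have x1 := hxt 1 (.inl rfl)
  have x2 := hxt 2 (.inr rfl)
  have y1 := hyt 1 (.inl rfl)
  have y2 := hyt 2 (.inr rfl)
  have hKK : ∀ z : ℂ, symSum (M + 2) t (fun u => Cf (M + 2) (k + 1) u *
      ((u (M + 1) 1)⁻¹ * fP (M + 2) x (k + 1) u 1) * ((u (M + 1) 2)⁻¹ * fP (M + 2) z l u 2)) =
      TS (M + 1) t (fun u => Kf x z (u (M + 1) 1) (u (M + 1) 2) *
        (Cc (k + 1) M u * Wt (k + 1) l (M + 1) u)) := by
    intro z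
    unfold symSum TS
    refine Finset.sum_congr rfl fun S _ => ?_
    simp only [hC, Kf, Wt, fP, e]
    ring
  constructor
  · rw [hKK, main_abs l k M (by omega) (by omega) t ht (Kf x y) (Hf x y)
      (KH x y _ _ htL1 htL2 x1 x2 y1 y2 hxy) (by unfold Hf; ring)]
    unfold symSum TS
    rw [Finset.mul_sum, ← Finset.sum_add_distrib]
    refine Finset.sum_congr rfl fun S _ => ?_
    simp only [Hf, Wt, fP, e]
    ring
  · rw [hKK, main_abs l k M (by omega) (by omega) t ht (Kf x x) (Kf x x)
      (KH' x _ _) (by unfold Kf; ring)]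
    unfold symSum TS
    refine Finset.sum_congr rfl fun S _ => ?_
    simp only [Kf, Wt, fP, e]
    ring
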